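/- arXiv:0901.3039 — 5 statements merged into one kernel-verified Lean document; each statement's English description precedes it below -/
import Mathlib

section
/- Let G be a finite group with subgroups H ≤ N ≤ G. The following are equivalent: (i) there exists a positive integer n such that for every irreducible character α of H and every irreducible character μ of G one has ⟨Ind_N^G(Res_N(Ind_H^G α)), μ⟩_G ≤ n · ⟨Ind_H^G α, μ⟩_G; (ii) H is contained in core_G(N) = ∩_{g∈G} g N g⁻¹. (This is the character-theoretic form of the theorem: the tower of complex group algebras ℂG ⊇ ℂN ⊇ ℂH is depth-3 if and only if H ⊆ core_G(N).) -/
open scoped BigOperators Classical ComplexOrder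

noncomputable def innerProd (K : Type) [Group K] [Fintype K] (φ φ' : K → ℂ) : ℂ :=
  (Fintype.card K : ℂ)⁻¹ * ∑ k : K, φ k * (starRingEnd ℂ) (φ' k)

noncomputable def ind {G : Type} [Group G] [Fintype G] (H : Subgroup G) (ψ : H → ℂ) :
    G → ℂ :=
  fun g => (Fintype.card H : ℂ)⁻¹ *
    ∑ x : G, if h : x⁻¹ * g * x ∈ H then ψ ⟨x⁻¹ * g * x, h⟩ else 0

def res {G : Type} [Group G] (H : Subgroup G) (φ : G → ℂ) : H → ℂ :=
  fun h => φ (h : G)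

def IsIrrChar (K : Type) [Group K] [Fintype K] (ψ : K → ℂ) : Prop :=
  ∃ V : FDRep ℂ K, CategoryTheory.Simple V ∧ ψ = V.character


/-- The permutation character of `G` on `G ⧸ N`. -/
noncomputable def permChar {G : Type} [Group G] [Fintype G] (N : Subgroup G) (g : G) : ℂ :=
  (Fintype.card N : ℂ)⁻¹ * ∑ x : G, if x⁻¹ * g * x ∈ N then 1 else 0

lemma ind_conj {G : Type} [Group G] [Fintype G] (H : Subgroup G) (ψ : H → ℂ) (g y : G) :
    ind H ψ (y⁻¹ * g * y) = ind H ψ g := by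
  unfold ind
  congr 1
  refine Fintype.sum_equiv (Equiv.mulLeft y) _ _ fun x => ?_
  have : x⁻¹ * (y⁻¹ * g * y) * x = (y * x)⁻¹ * g * (y * x) := by group
  simp only [this, Equiv.coe_mulLeft]
  by_cases hm : (y * x)⁻¹ * g * (y * x) ∈ H <;> simp [hm]

lemma permChar_conj {G : Type} [Group G] [Fintype G] (H : Subgroup G) (g y : G) :
    permChar H (y⁻¹ * g * y) = permChar H g := by
  unfold permChar
  congr 1
  refine Fintype.sum_equiv (Equiv.mulLeft y) _ _ fun x => ?_
  have : x⁻¹ * (y⁻¹ * g * y) * x = (y * x)⁻¹ * g * (y * x) := by group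
  simp only [this, Equiv.coe_mulLeft]
  by_cases hm : (y * x)⁻¹ * g * (y * x) ∈ H <;> simp [hm]

lemma ind_res {G : Type} [Group G] [Fintype G] (N : Subgroup G) (φ : G → ℂ)
    (hφ : ∀ g y, φ (y⁻¹ * g * y) = φ g) (g : G) :
    ind N (res N φ) g = φ g * permChar N g := by
  unfold ind res permChar
  rw [mul_left_comm (φ g), Finset.mul_sum _ _ (φ g)]
  congr 1
  refine Finset.sum_congr rfl fun x _ => ?_
  split_ifs <;> simp [hφ]

lemma sum_ind_mul {G : Type} [Group G] [Fintype G] (H : Subgroup G) (ψ : H → ℂ) (F : G → ℂ)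
    (hF : ∀ g y, F (y⁻¹ * g * y) = F g) :
    (Fintype.card G : ℂ)⁻¹ * ∑ g, ind H ψ g * F g =
      (Nat.card H : ℂ)⁻¹ * ∑ h : H, ψ h * F h := by
  have key : ∀ x : G, (∑ g : G, (if h : x⁻¹ * g * x ∈ H then ψ ⟨x⁻¹ * g * x, h⟩ else 0) * F g) =
      ∑ h : H, ψ h * F h := by
    intro x
    have e1 : (∑ g : G, (if h : x⁻¹ * g * x ∈ H then ψ ⟨x⁻¹ * g * x, h⟩ else 0) * F g) =
        ∑ g : G, (if h : g ∈ H then ψ ⟨g, h⟩ else 0) * F g := by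
      refine Fintype.sum_equiv (MulAut.conj x⁻¹).toEquiv _ _ fun g => ?_
      simp [hF]
    rw [e1]
    have e2 : ∀ g : G, (if h : g ∈ H then ψ ⟨g, h⟩ else 0) * F g =
        if h : g ∈ H then ψ ⟨g, h⟩ * F g else 0 := by
      intro g; split_ifs <;> simp
    simp only [e2]
    rw [Finset.sum_dite]
    simp only [Finset.sum_const_zero, add_zero]
    refine Fintype.sum_equiv (Equiv.subtypeEquivRight (by simp)) _ _ fun g => ?_
    rfl
  have : ∑ g, ind H ψ g * F g = (Nat.card H : ℂ)⁻¹ * ((Fintype.card G : ℂ) *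
      ∑ h : H, ψ h * F h) := by
    unfold ind
    simp only [mul_assoc (Fintype.card H : ℂ)⁻¹, Finset.sum_mul]
    rw [← Finset.mul_sum, Finset.sum_comm]
    simp only [key, Nat.card_eq_fintype_card]
    simp
  rw [this]
  have : (Fintype.card G : ℂ) ≠ 0 := by simp
  field_simp

/-- The permutation representation of `H` on functions on `G ⧸ N`. -/
noncomputable def permRep {G : Type} [Group G] (H N : Subgroup G) :
    Representation ℂ H (G ⧸ N → ℂ) where
  toFun h := LinearMap.funLeft ℂ ℂ (fun q => (h : G)⁻¹ • q)
  map_one' := by ext; simp [LinearMap.funLeft_apply]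
  map_mul' a b := by
    refine LinearMap.ext fun f => funext fun q => ?_
    simp [LinearMap.funLeft_apply, mul_smul]

lemma permRep_apply {G : Type} [Group G] (H N : Subgroup G) (h : H) (f : G ⧸ N → ℂ) (q : G ⧸ N) :
    permRep H N h f q = f ((h : G)⁻¹ • q) := rfl

lemma inv_smul_mk_eq {G : Type} [Group G] (N : Subgroup G) (g x : G) :
    g⁻¹ • (QuotientGroup.mk x : G ⧸ N) = QuotientGroup.mk x ↔ x⁻¹ * g * x ∈ N := by
  rw [← QuotientGroup.mk_mul_of_mem x (one_mem N), mul_one]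
  change (QuotientGroup.mk (g⁻¹ * x) : G ⧸ N) = QuotientGroup.mk x ↔ _
  rw [QuotientGroup.eq]
  simp [mul_assoc]

lemma permRep_character {G : Type} [Group G] [Fintype G] (H N : Subgroup G) (h : H) :
    (permRep H N).character h = permChar N (h : G) := by
  have h1 : (permRep H N).character h =
      ∑ q : G ⧸ N, if (h : G)⁻¹ • q = q then (1 : ℂ) else 0 := by
    unfold Representation.character
    rw [LinearMap.trace_eq_matrix_trace ℂ (Pi.basisFun ℂ (G ⧸ N)), Matrix.trace]
    refine Finset.sum_congr rfl fun q _ => ?_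
    simp [LinearMap.toMatrix_apply, permRep_apply, Pi.single_apply]
  have h2 : (∑ x : G, if x⁻¹ * (h : G) * x ∈ N then (1 : ℂ) else 0) =
      (Fintype.card N : ℂ) * ∑ q : G ⧸ N, if (h : G)⁻¹ • q = q then (1 : ℂ) else 0 := by
    simp only [← inv_smul_mk_eq]
    rw [← Finset.sum_fiberwise Finset.univ (fun x : G => (QuotientGroup.mk x : G ⧸ N)),
      Finset.mul_sum]
    refine Finset.sum_congr rfl fun q _ => ?_
    have hc : (Finset.univ.filter (fun x : G => (QuotientGroup.mk x : G ⧸ N) = q)).card =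
        Fintype.card N := by
      induction q using QuotientGroup.induction_on with
      | H y =>
        rw [← Finset.card_univ (α := N)]
        symm
        refine Finset.card_bij (fun n _ => y * (n : G)) ?_ ?_ ?_
        · intro n _; simp
        · intro a _ b _ hab; simpa using hab
        · intro b hb
          simp only [Finset.mem_filter, Finset.mem_univ, true_and] at hb
          exact ⟨⟨y⁻¹ * b, QuotientGroup.eq.1 hb.symm⟩, Finset.mem_univ _, by simp⟩
    rw [Finset.sum_congr rfl (g := fun _ => if (h : G)⁻¹ • q = q then (1 : ℂ) else 0)]
    · rw [Finset.sum_const, hc, nsmul_eq_mul]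
    · intro x hx
      simp only [Finset.mem_filter, Finset.mem_univ, true_and] at hx
      rw [hx]
  rw [h1, permChar, h2]
  have : (Fintype.card N : ℂ) ≠ 0 := by simp
  field_simp

lemma permChar_inv {G : Type} [Group G] [Fintype G] (N : Subgroup G) (g : G) :
    permChar N g⁻¹ = permChar N g := by
  unfold permChar
  congr 1
  refine Finset.sum_congr rfl fun x _ => ?_
  have : x⁻¹ * g⁻¹ * x = (x⁻¹ * g * x)⁻¹ := by group
  rw [this, inv_mem_iff]

open Representation in
/-- A representation on which `h` acts nontrivially has an irreducible constituent on which
`h` acts nontrivially. -/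
lemma exists_irr {H : Type} [Group H] [Fintype H] (h : H) : ∀ (d : ℕ) (W : Type) [AddCommGroup W]
    [Module ℂ W] [FiniteDimensional ℂ W] (σ : Representation ℂ H W) (_ : Module.finrank ℂ W = d)
    (w : W) (_ : σ h w ≠ w),
    ∃ (V : Type) (_ : AddCommGroup V) (_ : Module ℂ V) (_ : FiniteDimensional ℂ V)
      (ρ : Representation ℂ H V) (f : V →ₗ[ℂ] W), IsIrreducible ρ ∧
      Function.Injective f ∧ (∀ g v, f (ρ g v) = σ g (f v)) ∧ ∃ v, ρ h v ≠ v := by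
  intro d
  induction d using Nat.strong_induction_on with
  | _ d ih =>
  intro W _ _ _ σ hd w hw
  by_cases hirr : IsIrreducible σ
  · exact ⟨W, inferInstance, inferInstance, inferInstance, σ, LinearMap.id, hirr,
      Function.injective_id, fun _ _ => rfl, w, hw⟩
  have hw0 : w ≠ 0 := by rintro rfl; simp at hw
  have hnt : (⊥ : Subrepresentation σ) ≠ ⊤ := by
    intro e
    have : w ∈ (⊤ : Subrepresentation σ) := by
      change w ∈ (⊤ : Submodule ℂ W); trivial
    rw [← e] at this
    exact hw0 this
  have hS : ∃ S : Subrepresentation σ, S ≠ ⊥ ∧ S ≠ ⊤ := by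
    by_contra hcon
    push Not at hcon
    exact hirr { exists_pair_ne := ⟨_, _, hnt⟩
                 eq_bot_or_eq_top := fun S => or_iff_not_imp_left.2 (hcon S) }
  obtain ⟨S, hS0, hS1⟩ := hS
  haveI : NeZero (Nat.card H : ℂ) := ⟨by simp⟩
  obtain ⟨T, hT⟩ := exists_isCompl S
  have step : ∀ R : Subrepresentation σ, R ≠ ⊤ → (∃ r ∈ R.toSubmodule, σ h r ≠ r) →
    ∃ (V : Type) (_ : AddCommGroup V) (_ : Module ℂ V) (_ : FiniteDimensional ℂ V)
      (ρ : Representation ℂ H V) (f : V →ₗ[ℂ] W), IsIrreducible ρ ∧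
      Function.Injective f ∧ (∀ g v, f (ρ g v) = σ g (f v)) ∧ ∃ v, ρ h v ≠ v := by
    rintro R hR ⟨r, hr, hr'⟩
    have hlt : Module.finrank ℂ R.toSubmodule < d := by
      rw [← hd]
      apply Submodule.finrank_lt
      intro e
      exact hR (Subrepresentation.toSubmodule_injective e)
    obtain ⟨V, i1, i2, i3, ρ, f, h1, h2, h3, h4⟩ := ih _ hlt R.toSubmodule R.toRepresentation rfl
      ⟨r, hr⟩ (fun e => hr' (congrArg Subtype.val e))
    refine ⟨V, i1, i2, i3, ρ, R.toSubmodule.subtype ∘ₗ f, h1,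
      Subtype.val_injective.comp h2, fun g v => ?_, h4⟩
    simp only [LinearMap.comp_apply, h3]
    rfl
  have hT1 : T ≠ ⊤ := by
    rintro rfl
    exact hS0 (by simpa using hT.inf_eq_bot)
  have hsum : w ∈ S.toSubmodule ⊔ T.toSubmodule := by
    rw [← Subrepresentation.toSubmodule_sup, hT.sup_eq_top]
    change w ∈ (⊤ : Submodule ℂ W); trivial
  obtain ⟨s, hs, t, ht, rfl⟩ := Submodule.mem_sup.1 hsum
  by_cases hss : σ h s = s
  · refine step T hT1 ⟨t, ht, fun e => hw ?_⟩
    rw [map_add, hss, e]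
  · exact step S hS1 ⟨s, hs, hss⟩

open Representation in
lemma isIrrChar_of_irr {H : Type} [Group H] [Fintype H] {V : Type} [AddCommGroup V]
    [Module ℂ V] [FiniteDimensional ℂ V] (ρ : Representation ℂ H V) [IsIrreducible ρ] :
    IsIrrChar H ρ.character := by
  refine ⟨FDRep.of ρ, ?_, rfl⟩
  rw [FDRep.simple_iff_char_is_norm_one]
  have hne : (Nat.card H : ℂ) ≠ 0 := by simp
  haveI := invertibleOfNonzero hne
  have := char_orthonormal ρ ρ
  rw [if_pos ⟨Representation.Equiv.refl ρ⟩, inv_mul_eq_iff_eq_mul₀ hne, mul_one] at this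
  exact this

lemma isIrrChar_one (G : Type) [Group G] [Fintype G] : IsIrrChar G (fun _ => 1) := by
  refine ⟨FDRep.of (1 : Representation ℂ G ℂ), ?_, ?_⟩
  · rw [FDRep.simple_iff_char_is_norm_one]
    simp [FDRep.character]
  · funext g
    simp [FDRep.character]

open Representation in
lemma sum_char_irr {H : Type} [Group H] [Fintype H] {V : Type} [AddCommGroup V]
    [Module ℂ V] [FiniteDimensional ℂ V] (ρ : Representation ℂ H V) [IsIrreducible ρ]
    (h : H) (v : V) (hv : ρ h v ≠ v) :
    (Nat.card H : ℂ)⁻¹ * ∑ g : H, ρ.character g = 0 := by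
  have hne : (Nat.card H : ℂ) ≠ 0 := by simp
  haveI := invertibleOfNonzero hne
  rw [card_inv_mul_sum_char_eq_finrank]
  let I : Subrepresentation ρ := ⟨invariants ρ, fun g v hv => by
    rw [hv g]; exact hv⟩
  have hI : I = ⊥ := by
    refine (eq_bot_or_eq_top I).resolve_right fun e => hv ?_
    have : v ∈ (⊤ : Subrepresentation ρ) := by
      change v ∈ (⊤ : Submodule ℂ V); trivial
    rw [← e] at this
    exact this h
  have : invariants ρ = ⊥ := congrArg Subrepresentation.toSubmodule hI
  rw [this]
  simp

/-- A tower of finite groups `G ⊇ N ⊇ H` is depth-3 (in the character-theoretic sense: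
there is a positive integer `n` with
`⟨Ind_N^G (Res_N (Ind_H^G α)), μ⟩_G ≤ n ⟨Ind_H^G α, μ⟩_G` for all `α ∈ Irr(H)`,
`μ ∈ Irr(G)`) iff `H` is contained in the normal core of `N` in `G`. -/
theorem tower_depth3_iff_le_normalCore {G : Type} [Group G] [Fintype G]
    (H N : Subgroup G) (hHN : H ≤ N) :
    (∃ n : ℕ, 0 < n ∧ ∀ (α : H → ℂ) (μ : G → ℂ), IsIrrChar H α → IsIrrChar G μ →
      innerProd G (ind N (res N (ind H α))) μ ≤ (n : ℂ) * innerProd G (ind H α) μ) ↔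
    H ≤ N.normalCore := by
  constructor
  · rintro ⟨n, -, hn⟩ h hh b
    by_contra hb
    let σ := permRep H N
    let w : G ⧸ N → ℂ := Pi.single (QuotientGroup.mk b⁻¹) 1
    have hw : σ ⟨h, hh⟩ w ≠ w := by
      intro e
      have e1 := congrFun e (QuotientGroup.mk b⁻¹)
      have hne : ¬ (h⁻¹ • (QuotientGroup.mk b⁻¹ : G ⧸ N) = QuotientGroup.mk b⁻¹) := by
        rw [inv_smul_mk_eq]
        simpa using hb
      rw [permRep_apply] at e1
      exact hne (by simpa [w, Pi.single_apply] using e1)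
    obtain ⟨V, _, _, _, ρ, f, hirr, hinj, hcomm, v, hv⟩ :=
      exists_irr (⟨h, hh⟩ : H) _ _ σ rfl w hw
    have hne : (Nat.card H : ℂ) ≠ 0 := by simp
    haveI := invertibleOfNonzero hne
    have key := hn ρ.character (fun _ => 1) (isIrrChar_of_irr ρ) (isIrrChar_one G)
    have e1 : innerProd G (ind H ρ.character) (fun _ => 1) = 0 := by
      have := sum_ind_mul H ρ.character (fun _ => 1) (fun _ _ => rfl)
      simp only [mul_one] at this
      simp only [innerProd, map_one, mul_one]
      rw [this]
      exact sum_char_irr ρ _ v hv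
    have e2 : innerProd G (ind N (res N (ind H ρ.character))) (fun _ => 1) =
        Module.finrank ℂ (Representation.IntertwiningMap ρ σ) := by
      simp only [innerProd, map_one, mul_one]
      simp only [ind_res N _ (ind_conj H ρ.character)]
      rw [sum_ind_mul H _ _ (permChar_conj N),
        ← Representation.card_inv_mul_sum_char_mul_char_eq_finrank]
      congr 1
      refine Fintype.sum_equiv (Equiv.inv H) _ _ fun g => ?_
      simp only [Equiv.inv_apply, inv_inv, σ, permRep_character]
      rw [mul_comm]
      congr 1
      exact (permChar_inv N _).symm
    rw [e1, e2, mul_zero] at key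
    have hz : Module.finrank ℂ (Representation.IntertwiningMap ρ σ) = 0 := by
      exact Nat.le_zero.1 (by exact_mod_cast key)
    let F : Representation.IntertwiningMap ρ σ := ⟨f, fun g => LinearMap.ext (hcomm g)⟩
    have hF : F = 0 := by
      haveI : Module.Finite ℂ (Representation.IntertwiningMap ρ σ) :=
        Module.Finite.equiv (Representation.invariantsEquivIntertwiningMap ρ σ)
      exact (Module.finrank_zero_iff.1 hz).elim _ _
    have hf0 : f = 0 := congrArg (fun F => Representation.IntertwiningMap.toLinearMap F) hF
    apply hv
    apply hinj
    simp [hf0]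
  · intro hle
    refine ⟨N.index, Nat.pos_of_ne_zero Subgroup.index_ne_zero_of_finite, fun α μ _ _ => ?_⟩
    have : ∀ g, ind N (res N (ind H α)) g = (N.index : ℂ) * ind H α g := by
      intro g
      rw [ind_res N _ (ind_conj H α)]
      by_cases hg : ∃ x : G, x⁻¹ * g * x ∈ H
      · obtain ⟨x, hx⟩ := hg
        have hgN : g ∈ N.normalCore := by
          have := N.normalCore_normal.conj_mem _ (hle hx) x
          simpa [mul_assoc] using this
        have : permChar N g = N.index := by
          have h1 : ∀ y : G, y⁻¹ * g * y ∈ N := fun y => by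
            simpa using hgN y⁻¹
          have h2 := N.card_mul_index
          simp only [permChar, h1, if_true, Finset.sum_const, Finset.card_univ, nsmul_eq_mul,
            mul_one]
          rw [← Nat.card_eq_fintype_card, ← Nat.card_eq_fintype_card, ← h2]
          have : (Nat.card N : ℂ) ≠ 0 := by simp
          push_cast
          field_simp
        rw [this, mul_comm]
      · push Not at hg
        have : ind H α g = 0 := by
          simp [ind, hg]
        simp [this]
    apply le_of_eq
    simp only [innerProd, this, mul_assoc]
    rw [← Finset.mul_sum, mul_left_comm]
end

section
/- Let H be a subgroup of a finite group G, with induction-restriction matrix M and S = M Mᵀ. Then there exists a positive integer n with (S³)_{ψ,ψ'} ≤ n · S_{ψ,ψ'} for all ψ, ψ' ∈ Irr(H) if and only if there exists a positive integer n such that ⟨Res_H(Ind_H^G(Res_H(Ind_H^G ψ))), ψ'⟩_H ≤ n · ⟨Res_H(Ind_H^G ψ), ψ'⟩_H for all ψ, ψ' ∈ Irr(H). (Both conditions characterize H being a depth three subgroup of G.) -/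
open scoped BigOperators Classical ComplexOrder

/-- The induction-restriction matrix of `H ≤ G`: `M ψ χ = ⟨Ind_H^G ψ, χ⟩_G`. -/
noncomputable def indResMat {G : Type} [Group G] [Fintype G] (H : Subgroup G) :
    Matrix {ψ : H → ℂ // IsIrrChar H ψ} {χ : G → ℂ // IsIrrChar G χ} ℂ :=
  fun ψ χ => innerProd G (ind H ψ.1) χ.1

/-- The symmetric matrix `S = M Mᵀ`, `S ψ ψ' = ∑_{χ ∈ Irr G} M ψ χ * M ψ' χ`. -/
noncomputable def symMat {G : Type} [Group G] [Fintype G] (H : Subgroup G)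
    [Fintype {χ : G → ℂ // IsIrrChar G χ}] :
    Matrix {ψ : H → ℂ // IsIrrChar H ψ} {ψ : H → ℂ // IsIrrChar H ψ} ℂ :=
  fun ψ ψ' => ∑ χ : {χ : G → ℂ // IsIrrChar G χ}, indResMat H ψ χ * indResMat H ψ' χ


lemma char_inv_eq_conj {K : Type} [Group K] [Fintype K] (V : FDRep ℂ K) (g : K) :
    V.character g⁻¹ = (starRingEnd ℂ) (V.character g) := by
  let b := Module.finBasis ℂ V
  let R : K → Matrix _ _ ℂ := fun g => LinearMap.toMatrix b b (V.ρ g)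
  have Rmul : ∀ x y, R (x * y) = R x * R y := by
    intro x y
    simp only [R, map_mul]
    exact LinearMap.toMatrix_mul b _ _
  have Rone : R 1 = 1 := by
    simp only [R, map_one]
    exact LinearMap.toMatrix_one b
  have htr : ∀ x, V.character x = (R x).trace := by
    intro x
    exact LinearMap.trace_eq_matrix_trace ℂ b (V.ρ x)
  let P : Matrix _ _ ℂ := ∑ x : K, (R x).conjTranspose * R x
  have hP : P.PosDef := by
    have h1 : P = (R 1).conjTranspose * R 1
        + ∑ x ∈ Finset.univ.erase (1 : K), (R x).conjTranspose * R x :=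
      (Finset.add_sum_erase _ _ (Finset.mem_univ (1 : K))).symm
    rw [h1, Rone]
    refine Matrix.PosDef.add_posSemidef ?_ ?_
    · simpa using Matrix.PosDef.one
    · exact Matrix.posSemidef_sum _ fun x _ => Matrix.posSemidef_conjTranspose_mul_self _
  have hU : IsUnit P.det := (Matrix.isUnit_iff_isUnit_det _).1 hP.isUnit
  have hinv : (R g).conjTranspose * P * R g = P := by
    simp only [P, Finset.mul_sum, Finset.sum_mul]
    refine Fintype.sum_equiv (Equiv.mulRight g) _ _ fun x => ?_
    simp [Rmul, Matrix.conjTranspose_mul, Matrix.mul_assoc]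
  have h2 : (R g).conjTranspose * P = P * R g⁻¹ := by
    calc (R g).conjTranspose * P = (R g).conjTranspose * P * (R g * R g⁻¹) := by
          rw [← Rmul, mul_inv_cancel, Rone, mul_one]
      _ = P * R g⁻¹ := by rw [← mul_assoc, hinv]
  have h3 : R g⁻¹ = P⁻¹ * ((R g).conjTranspose * P) := by
    rw [h2, ← mul_assoc, Matrix.nonsing_inv_mul _ hU, one_mul]
  rw [htr, htr, h3, Matrix.trace_mul_comm, mul_assoc, Matrix.mul_nonsing_inv _ hU, mul_one,
    Matrix.trace_conjTranspose]
  rfl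

lemma schur_zero {K V : Type} [Group K] [Fintype K] [AddCommGroup V] [Module ℂ V]
    [FiniteDimensional ℂ V] (ρ : Representation ℂ K V) [ρ.IsIrreducible] (f : K → ℂ)
    (hf : ∀ g x, f (x * g * x⁻¹) = f g) (h : ∑ k, f k * ρ.character k⁻¹ = 0) :
    ∑ k, f k • ρ k⁻¹ = 0 := by
  have hint : ∀ (g : K), (∑ k, f k • ρ k⁻¹) ∘ₗ ρ g = ρ g ∘ₗ (∑ k, f k • ρ k⁻¹) := by
    intro g
    change (∑ k, f k • ρ k⁻¹) * ρ g = ρ g * (∑ k, f k • ρ k⁻¹)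
    rw [Finset.sum_mul, Finset.mul_sum]
    refine Fintype.sum_equiv (MulAut.conj g⁻¹).toEquiv _ _ fun x => ?_
    have : (MulAut.conj g⁻¹).toEquiv x = g⁻¹ * x * g⁻¹⁻¹ := rfl
    rw [this, hf, smul_mul_assoc, mul_smul_comm, ← map_mul, ← map_mul]
    congr 2
    group
  let T : Representation.IntertwiningMap ρ ρ := ⟨∑ k, f k • ρ k⁻¹, hint⟩
  obtain ⟨c, hc⟩ :=
    (Representation.IsIrreducible.algebraMap_intertwiningMap_bijective_of_isAlgClosed (ρ := ρ)).2 T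
  have hc' : (∑ k, f k • ρ k⁻¹) = c • (1 : V →ₗ[ℂ] V) := by
    ext v
    have := congrArg (fun S : Representation.IntertwiningMap ρ ρ => S.toLinearMap v) hc
    exact this.symm
  have htr := congrArg (LinearMap.trace ℂ V) hc'
  rw [map_sum] at htr
  simp only [map_smul, smul_eq_mul, LinearMap.trace_one] at htr
  have : ∑ k, f k * ρ.character k⁻¹ = c * (Module.finrank ℂ V : ℂ) := htr
  rw [h] at this
  have hne : Nontrivial V := by
    by_contra hn
    rw [not_nontrivial_iff_subsingleton] at hn
    obtain ⟨a, b, hab⟩ := (inferInstance : Nontrivial (Subrepresentation ρ))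
    apply hab
    ext v
    rw [Subsingleton.elim v 0]
    exact ⟨fun _ => b.toSubmodule.zero_mem, fun _ => a.toSubmodule.zero_mem⟩
  have h0 : (Module.finrank ℂ V : ℂ) ≠ 0 := by
    exact_mod_cast (Module.finrank_pos (R := ℂ) (M := V)).ne'
  have : c = 0 := by
    rcases mul_eq_zero.1 this.symm with h | h
    · exact h
    · exact absurd h h0
  rw [hc', this, zero_smul]

lemma simple_of_irr {K V : Type} [Group K] [Fintype K] [AddCommGroup V] [Module ℂ V]
    [FiniteDimensional ℂ V] (ρ : Representation ℂ K V) [ρ.IsIrreducible] :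
    CategoryTheory.Simple (FDRep.of ρ) := by
  have hne : (Nat.card K : ℂ) ≠ 0 := by exact_mod_cast Nat.card_pos.ne'
  have : Invertible (Nat.card K : ℂ) := invertibleOfNonzero hne
  rw [FDRep.simple_iff_char_is_norm_one]
  have := Representation.char_orthonormal ρ ρ
  rw [if_pos ⟨Representation.Equiv.refl ρ⟩, inv_mul_eq_one₀ hne] at this
  exact this.symm

lemma acts_zero {K : Type} [Group K] [Fintype K] (f : K → ℂ)
    (hf : ∀ g x, f (x * g * x⁻¹) = f g)
    (h : ∀ χ, IsIrrChar K χ → innerProd K f χ = 0)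
    (M : Type) [AddCommGroup M] [Module ℂ M] [Module (MonoidAlgebra ℂ K) M]
    [IsScalarTower ℂ (MonoidAlgebra ℂ K) M]
    [Module.Finite ℂ M]
    (hs : IsSimpleModule (MonoidAlgebra ℂ K) M) (v : M) :
    (∑ k, MonoidAlgebra.single k⁻¹ (f k) : MonoidAlgebra ℂ K) • v = 0 := by
  let σ : Representation ℂ K M := Representation.ofModule' M
  have hσ : ∀ (r : MonoidAlgebra ℂ K) (m : M), σ.asAlgebraHom r m = r • m := by
    intro r m
    have : σ.asAlgebraHom = Algebra.lsmul ℂ ℂ M :=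
      (MonoidAlgebra.lift ℂ (M →ₗ[ℂ] M) K).apply_symm_apply _
    rw [this]
    rfl
  let e : σ.asModule ≃ₗ[MonoidAlgebra ℂ K] M :=
    { σ.asModuleEquiv.toAddEquiv with
      map_smul' := by
        intro r x
        have h1 := σ.asModuleEquiv_map_smul r x
        rw [hσ] at h1
        exact h1 }
  have : σ.IsIrreducible :=
    (Representation.irreducible_iff_isSimpleModule_asModule σ).2 (IsSimpleModule.congr e)
  have hx := h (FDRep.of σ).character ⟨FDRep.of σ, simple_of_irr σ, rfl⟩
  have hsum : ∑ k, f k * σ.character k⁻¹ = 0 := by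
    unfold innerProd at hx
    simp only [← char_inv_eq_conj] at hx
    have hne : (Fintype.card K : ℂ)⁻¹ ≠ 0 := by
      simp [Fintype.card_ne_zero]
    exact (mul_eq_zero.1 hx).resolve_left hne
  have h0 := schur_zero σ f hf hsum
  have h1 : σ.asAlgebraHom (∑ k, MonoidAlgebra.single k⁻¹ (f k)) = 0 := by
    rw [← h0]
    simp only [map_sum, Representation.asAlgebraHom_single]
  rw [← hσ, h1, LinearMap.zero_apply]

lemma class_zero {K : Type} [Group K] [Fintype K] (f : K → ℂ)
    (hf : ∀ g x, f (x * g * x⁻¹) = f g)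
    (h : ∀ χ, IsIrrChar K χ → innerProd K f χ = 0) : f = 0 := by
  have : NeZero (Nat.card K : ℂ) := ⟨by exact_mod_cast Nat.card_pos.ne'⟩
  have ha : (∑ k, MonoidAlgebra.single k⁻¹ (f k) : MonoidAlgebra ℂ K) ∈
      Ring.jacobson (MonoidAlgebra ℂ K) := by
    rw [Ring.jacobson, Module.jacobson, Submodule.mem_sInf]
    intro m hm
    have hs : IsSimpleModule (MonoidAlgebra ℂ K) (MonoidAlgebra ℂ K ⧸ m) :=
      isSimpleModule_iff_isCoatom.2 hm
    have : Module.Finite ℂ (MonoidAlgebra ℂ K ⧸ m) :=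
      Module.Finite.trans (MonoidAlgebra ℂ K) _
    have h2 := acts_zero f hf h (MonoidAlgebra ℂ K ⧸ m) hs (Submodule.Quotient.mk 1)
    rw [← Submodule.Quotient.mk_smul, Submodule.Quotient.mk_eq_zero] at h2
    simpa using h2
  rw [IsSemisimpleRing.jacobson_eq_bot, Submodule.mem_bot] at ha
  funext k
  have := congrArg (fun p : MonoidAlgebra ℂ K => p.coeff k⁻¹) ha
  simpa [Finsupp.single_apply] using this

lemma innerProd_sum {K ι : Type} [Group K] [Fintype K] [Fintype ι] (c : ι → ℂ) (φ : ι → K → ℂ)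
    (θ : K → ℂ) :
    innerProd K (fun g => ∑ i, c i * φ i g) θ = ∑ i, c i * innerProd K (φ i) θ := by
  unfold innerProd
  simp only [Finset.sum_mul, Finset.mul_sum]
  rw [Finset.sum_comm]
  refine Finset.sum_congr rfl fun i _ => Finset.sum_congr rfl fun k _ => ?_
  ring

lemma innerProd_conj {K : Type} [Group K] [Fintype K] (φ θ : K → ℂ) :
    innerProd K φ θ = (starRingEnd ℂ) (innerProd K θ φ) := by
  unfold innerProd
  simp only [map_mul, map_sum, map_inv₀, map_natCast, Complex.conj_conj]
  congr 1
  refine Finset.sum_congr rfl fun k _ => ?_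
  ring

lemma irr_class {K : Type} [Group K] [Fintype K] {χ : K → ℂ} (hχ : IsIrrChar K χ) (g x : K) :
    χ (x * g * x⁻¹) = χ g := by
  obtain ⟨V, _, rfl⟩ := hχ
  exact FDRep.char_conj V g x

lemma innerProd_char {K : Type} [Group K] [Fintype K] (V W : FDRep ℂ K) :
    innerProd K V.character W.character = (Module.finrank ℂ (W ⟶ V) : ℂ) := by
  have hne : (Nat.card K : ℂ) ≠ 0 := by exact_mod_cast Nat.card_pos.ne'
  have : Invertible (Nat.card K : ℂ) := invertibleOfNonzero hne
  rw [← FDRep.scalar_product_char_eq_finrank_equivariant]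
  unfold innerProd
  simp only [← char_inv_eq_conj, Nat.card_eq_fintype_card]

lemma innerProd_irr {K : Type} [Group K] [Fintype K] {χ χ' : K → ℂ} (hχ : IsIrrChar K χ)
    (hχ' : IsIrrChar K χ') : innerProd K χ χ' = if χ = χ' then 1 else 0 := by
  obtain ⟨V, hV, rfl⟩ := hχ
  obtain ⟨W, hW, rfl⟩ := hχ'
  split_ifs with h
  · rw [← h, innerProd_char, FDRep.finrank_hom_simple_simple, if_pos ⟨CategoryTheory.Iso.refl _⟩]
    simp
  · rw [innerProd_char, FDRep.finrank_hom_simple_simple, if_neg]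
    · simp
    · rintro ⟨i⟩
      exact h (FDRep.char_iso i).symm

lemma class_expand {K : Type} [Group K] [Fintype K] [Fintype {χ : K → ℂ // IsIrrChar K χ}]
    (f : K → ℂ) (hf : ∀ g x, f (x * g * x⁻¹) = f g) :
    f = fun g => ∑ χ : {χ : K → ℂ // IsIrrChar K χ}, innerProd K f χ.1 * χ.1 g := by
  have key := class_zero
    (fun g => f g - ∑ χ : {χ : K → ℂ // IsIrrChar K χ}, innerProd K f χ.1 * χ.1 g) ?_ ?_
  · funext g
    exact sub_eq_zero.1 (congrFun key g)
  · intro g x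
    simp only [hf, irr_class (Subtype.prop _)]
  · intro θ hθ
    have h1 : innerProd K (fun g => f g -
        ∑ χ : {χ : K → ℂ // IsIrrChar K χ}, innerProd K f χ.1 * χ.1 g) θ =
        innerProd K f θ - innerProd K (fun g =>
          ∑ χ : {χ : K → ℂ // IsIrrChar K χ}, innerProd K f χ.1 * χ.1 g) θ := by
      simp only [innerProd, sub_mul, Finset.sum_sub_distrib, mul_sub]
    rw [h1, innerProd_sum, Finset.sum_eq_single (⟨θ, hθ⟩ : {χ : K → ℂ // IsIrrChar K χ})]
    · rw [innerProd_irr hθ hθ]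
      simp
    · intro χ _ hne
      rw [innerProd_irr χ.2 hθ, if_neg, mul_zero]
      exact fun h => hne (Subtype.ext h)
    · simp

lemma ind_class {G : Type} [Group G] [Fintype G] (H : Subgroup G) (ψ : H → ℂ) (g y : G) :
    ind H ψ (y * g * y⁻¹) = ind H ψ g := by
  unfold ind
  congr 1
  refine Fintype.sum_equiv (Equiv.mulLeft y⁻¹) _ _ fun x => ?_
  have : x⁻¹ * (y * g * y⁻¹) * x = (y⁻¹ * x)⁻¹ * g * (y⁻¹ * x) := by group
  have aux : ∀ u v : G, u = v → (if h : u ∈ H then ψ ⟨u, h⟩ else 0) =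
      (if h : v ∈ H then ψ ⟨v, h⟩ else 0) := by
    rintro u _ rfl
    rfl
  exact aux _ _ this

lemma ind_sum {G ι : Type} [Group G] [Fintype G] [Fintype ι] (H : Subgroup G)
    (c : ι → ℂ) (φ : ι → H → ℂ) :
    ind H (fun g => ∑ i, c i * φ i g) = fun g => ∑ i, c i * ind H (φ i) g := by
  funext g
  unfold ind
  simp only [Finset.mul_sum]
  rw [Finset.sum_comm]
  refine Finset.sum_congr rfl fun x _ => ?_
  split_ifs with h
  · rw [Finset.mul_sum]
    exact Finset.sum_congr rfl fun i _ => by ring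
  · simp

lemma frob {G : Type} [Group G] [Fintype G] (H : Subgroup G) (ψ : H → ℂ) (φ : G → ℂ)
    (hφ : ∀ g x, φ (x * g * x⁻¹) = φ g) :
    innerProd G (ind H ψ) φ = innerProd H ψ (res H φ) := by
  have hG : (Fintype.card G : ℂ) ≠ 0 := by simp [Fintype.card_ne_zero]
  have key : ∀ x : G, (∑ g : G, (if h : x⁻¹ * g * x ∈ H then ψ ⟨x⁻¹ * g * x, h⟩ else 0) *
      (starRingEnd ℂ) (φ g)) = ∑ h : H, ψ h * (starRingEnd ℂ) (φ h) := by
    intro x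
    have h1 : (∑ g : G, (if h : x⁻¹ * g * x ∈ H then ψ ⟨x⁻¹ * g * x, h⟩ else 0) *
        (starRingEnd ℂ) (φ g)) =
        ∑ g : G, (if h : g ∈ H then ψ ⟨g, h⟩ else 0) * (starRingEnd ℂ) (φ g) := by
      refine Fintype.sum_equiv (MulAut.conj x⁻¹).toEquiv _ _ fun g => ?_
      have h2 : (MulAut.conj x⁻¹).toEquiv g = x⁻¹ * g * x⁻¹⁻¹ := rfl
      rw [h2, hφ]
      simp only [inv_inv]
    rw [h1]
    have h3 : ∀ g : G, (if h : g ∈ H then ψ ⟨g, h⟩ else 0) * (starRingEnd ℂ) (φ g) =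
        if h : g ∈ H then ψ ⟨g, h⟩ * (starRingEnd ℂ) (φ g) else 0 := by
      intro g
      split_ifs <;> simp
    simp only [h3]
    rw [Finset.sum_dite, Finset.sum_const_zero, add_zero]
    refine Finset.sum_bij' (fun g _ => ⟨g.1, (Finset.mem_filter.1 g.2).2⟩)
      (fun h _ => ⟨h.1, by simp⟩) ?_ ?_ ?_ ?_ ?_ <;> simp
  unfold innerProd
  have h4 : ∑ g : G, ind H ψ g * (starRingEnd ℂ) (φ g) =
      (Fintype.card H : ℂ)⁻¹ * ∑ x : G, ∑ g : G,
        (if h : x⁻¹ * g * x ∈ H then ψ ⟨x⁻¹ * g * x, h⟩ else 0) * (starRingEnd ℂ) (φ g) := by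
    rw [Finset.sum_comm, Finset.mul_sum]
    refine Finset.sum_congr rfl fun g _ => ?_
    rw [ind, mul_assoc, Finset.sum_mul]
  rw [h4]
  simp only [key, Finset.sum_const, Finset.card_univ, nsmul_eq_mul, res]
  field_simp

lemma indResMat_nat {G : Type} [Group G] [Fintype G] (H : Subgroup G)
    (ψ : {ψ : H → ℂ // IsIrrChar H ψ}) (χ : {χ : G → ℂ // IsIrrChar G χ}) :
    ∃ m : ℕ, indResMat H ψ χ = m := by
  obtain ⟨ψ, V, hV, rfl⟩ := ψ
  obtain ⟨χ, W, hW, rfl⟩ := χ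
  refine ⟨Module.finrank ℂ (FDRep.of ((W.ρ : Representation ℂ G W).comp H.subtype) ⟶ V),
    (frob H _ _ (fun g x => FDRep.char_conj W g x)).trans ?_⟩
  exact innerProd_char V (FDRep.of ((W.ρ : Representation ℂ G W).comp H.subtype))

lemma symMat_eq {G : Type} [Group G] [Fintype G] (H : Subgroup G)
    [Fintype {χ : G → ℂ // IsIrrChar G χ}] (ψ ψ' : {ψ : H → ℂ // IsIrrChar H ψ}) :
    innerProd H (res H (ind H ψ.1)) ψ'.1 = symMat H ψ ψ' := by
  have h1 : res H (ind H ψ.1) = fun h => ∑ χ : {χ : G → ℂ // IsIrrChar G χ},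
      indResMat H ψ χ * res H χ.1 h := by
    funext h
    exact congrFun (class_expand (ind H ψ.1) (ind_class H ψ.1)) h
  rw [h1, innerProd_sum]
  unfold symMat
  refine Finset.sum_congr rfl fun χ _ => ?_
  rw [innerProd_conj, ← frob H _ _ (irr_class χ.2)]
  obtain ⟨m, hm⟩ := indResMat_nat H ψ' χ
  have : innerProd G (ind H ψ'.1) χ.1 = m := hm
  rw [this, hm, map_natCast]

lemma symMat_sq_eq {G : Type} [Group G] [Fintype G] (H : Subgroup G)
    [Fintype {ψ : H → ℂ // IsIrrChar H ψ}]
    [Fintype {χ : G → ℂ // IsIrrChar G χ}] (ψ ψ' : {ψ : H → ℂ // IsIrrChar H ψ}) :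
    innerProd H (res H (ind H (res H (ind H ψ.1)))) ψ'.1 = ∑ θ, symMat H ψ θ * symMat H θ ψ' := by
  have h1 : res H (ind H ψ.1) = fun h => ∑ θ : {ψ : H → ℂ // IsIrrChar H ψ},
      symMat H ψ θ * θ.1 h := by
    simp only [← symMat_eq]
    exact class_expand _ (fun g x => ind_class H ψ.1 g x)
  rw [h1, ind_sum]
  have h2 : res H (fun g => ∑ θ : {ψ : H → ℂ // IsIrrChar H ψ},
      symMat H ψ θ * ind H θ.1 g) = fun h => ∑ θ : {ψ : H → ℂ // IsIrrChar H ψ},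
      symMat H ψ θ * res H (ind H θ.1) h := rfl
  rw [h2, innerProd_sum]
  simp only [symMat_eq]

lemma symMat_diag {G : Type} [Group G] [Fintype G] (H : Subgroup G)
    [Fintype {χ : G → ℂ // IsIrrChar G χ}] (ψ : {ψ : H → ℂ // IsIrrChar H ψ}) :
    symMat H ψ ψ ≠ 0 := by
  intro h
  choose m hm using indResMat_nat H ψ
  have h0 : ∀ χ, m χ = 0 := by
    simp only [symMat, hm] at h
    norm_cast at h
    intro χ
    have := (Finset.sum_eq_zero_iff.1 h) χ (Finset.mem_univ _)
    simpa using this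
  have h1 : ind H ψ.1 = 0 := by
    apply class_zero _ (ind_class H ψ.1)
    intro χ hχ
    have := hm ⟨χ, hχ⟩
    rw [h0, Nat.cast_zero] at this
    exact this
  have h2 := congrFun h1 1
  have h3 : ψ.1 1 ≠ 0 := by
    have hn := innerProd_irr ψ.2 ψ.2
    obtain ⟨ψ, V, hV, rfl⟩ := ψ
    intro h4
    have h5 : Module.finrank ℂ V = 0 := by
      have h4' : V.character 1 = 0 := h4
      rw [FDRep.char_one] at h4'
      exact_mod_cast h4'
    have h6 : Subsingleton V := Module.finrank_zero_iff.1 h5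
    have h7 : V.character = 0 := by
      funext g
      have : V.ρ g = 0 := by
        ext v
        exact Subsingleton.elim _ _
      simp [FDRep.character, this]
    simp only [if_true] at hn
    rw [h7] at hn
    simp [innerProd] at hn
  have h8 : ∀ x : G, (if h : x⁻¹ * 1 * x ∈ H then ψ.1 ⟨x⁻¹ * 1 * x, h⟩ else 0) = ψ.1 1 := by
    intro x
    have h9 : x⁻¹ * 1 * x = 1 := by group
    simp only [h9, H.one_mem, dif_pos]
    rfl
  simp only [ind, h8] at h2
  simp [Fintype.card_ne_zero] at h2
  exact h3 h2

lemma nat_depth {ι : Type} [Fintype ι] (N : ι → ι → ℕ) (hd : ∀ i, N i i ≠ 0) :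
    (∃ n : ℕ, 0 < n ∧ ∀ i j, ∑ b, (∑ a, N i a * N a b) * N b j ≤ n * N i j) ↔
    (∃ n : ℕ, 0 < n ∧ ∀ i j, ∑ a, N i a * N a j ≤ n * N i j) := by
  constructor
  · rintro ⟨n, hn, h⟩
    refine ⟨n, hn, fun i j => le_trans ?_ (h i j)⟩
    calc ∑ a, N i a * N a j ≤ (∑ a, N i a * N a j) * N j j :=
          Nat.le_mul_of_pos_right _ (Nat.pos_of_ne_zero (hd j))
      _ ≤ _ := Finset.single_le_sum (f := fun b => (∑ a, N i a * N a b) * N b j)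
          (fun _ _ => Nat.zero_le _) (Finset.mem_univ j)
  · rintro ⟨n, hn, h⟩
    refine ⟨n * n, Nat.mul_pos hn hn, fun i j => ?_⟩
    calc ∑ b, (∑ a, N i a * N a b) * N b j ≤ ∑ b, (n * N i b) * N b j :=
          Finset.sum_le_sum fun b _ => Nat.mul_le_mul_right _ (h i b)
      _ = n * ∑ b, N i b * N b j := by
          rw [Finset.mul_sum]
          exact Finset.sum_congr rfl fun b _ => by ring
      _ ≤ n * (n * N i j) := Nat.mul_le_mul_left _ (h i j)
      _ = n * n * N i j := by ring

/-- `S³ ≤ n S` entrywise for some positive integer `n` iff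
`⟨Res Ind Res Ind ψ, ψ'⟩_H ≤ n ⟨Res Ind ψ, ψ'⟩_H` for some positive integer `n`
and all `ψ, ψ' ∈ Irr(H)` (depth three). -/
theorem symMat_cube_depth_three_iff {G : Type} [Group G] [Fintype G] (H : Subgroup G)
    [Fintype {ψ : H → ℂ // IsIrrChar H ψ}] [Fintype {χ : G → ℂ // IsIrrChar G χ}] :
    (∃ n : ℕ, 0 < n ∧ ∀ ψ ψ' : {ψ : H → ℂ // IsIrrChar H ψ},
      (symMat H ^ 3) ψ ψ' ≤ (n : ℂ) * symMat H ψ ψ') ↔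
    (∃ n : ℕ, 0 < n ∧ ∀ ψ ψ' : {ψ : H → ℂ // IsIrrChar H ψ},
      innerProd H (res H (ind H (res H (ind H ψ.1)))) ψ'.1
        ≤ (n : ℂ) * innerProd H (res H (ind H ψ.1)) ψ'.1) := by
  have hN : ∀ ψ ψ', ∃ m : ℕ, symMat H ψ ψ' = m := by
    intro ψ ψ'
    choose m hm using indResMat_nat H ψ
    choose m' hm' using indResMat_nat H ψ'
    refine ⟨∑ χ, m χ * m' χ, ?_⟩
    simp [symMat, hm, hm']
  choose N hN using hN
  have hd : ∀ ψ, N ψ ψ ≠ 0 := by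
    intro ψ h0
    apply symMat_diag H ψ
    rw [hN, h0, Nat.cast_zero]
  have h3 : ∀ ψ ψ', (symMat H ^ 3) ψ ψ' =
      ((∑ b, (∑ a, N ψ a * N a b) * N b ψ' : ℕ) : ℂ) := by
    intro ψ ψ'
    rw [pow_succ, pow_two]
    simp only [Matrix.mul_apply, hN]
    push_cast
    rfl
  simp only [h3, symMat_sq_eq, symMat_eq, hN]
  have := nat_depth N hd
  exact_mod_cast this
end

section
/- Let A be a finite-dimensional Hopf algebra over ℂ which is semisimple as a ring. Let K and L be Hopf subalgebras of A, and suppose Λ_K ∈ K and Λ_L ∈ L are two-sided idempotent integrals of K and L respectively. If Λ_K · Λ_L = Λ_L in A, then K ⊆ L. -/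
open scoped TensorProduct

/-- A Hopf subalgebra of a Hopf algebra `A` over `ℂ`: a subalgebra `K` such that
`Δ(K)` lands in the image of `K ⊗ K` in `A ⊗ A` and the antipode maps `K` into `K`. -/
def IsHopfSubalgebra {A : Type} [Semiring A] [HopfAlgebra ℂ A]
    (K : Subalgebra ℂ A) : Prop :=
  (∀ x ∈ K, Coalgebra.comul (R := ℂ) x ∈
    LinearMap.range (TensorProduct.map K.val.toLinearMap K.val.toLinearMap)) ∧
  (∀ x ∈ K, HopfAlgebra.antipode (R := ℂ) x ∈ K)

/-- A two-sided idempotent integral of a Hopf subalgebra `K`: an element `Λ ∈ K`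
with `ε(Λ) = 1` and `x * Λ = ε(x) • Λ = Λ * x` for all `x ∈ K`. -/
def IsIdempotentIntegral {A : Type} [Semiring A] [HopfAlgebra ℂ A]
    (K : Subalgebra ℂ A) (Λ : A) : Prop :=
  Λ ∈ K ∧ Coalgebra.counit (R := ℂ) Λ = 1 ∧
    ∀ x ∈ K, x * Λ = Coalgebra.counit (R := ℂ) x • Λ ∧
      Λ * x = Coalgebra.counit (R := ℂ) x • Λ

open Coalgebra HopfAlgebra in
/-- `∑ (S(x₁) ⊗ 1) Δ(x₂) = 1 ⊗ x`. -/
theorem aux_identity {A : Type} [Ring A] [HopfAlgebra ℂ A] (x : A) :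
    TensorProduct.lift ((LinearMap.mul ℂ (A ⊗[ℂ] A)).compl₁₂
      ((TensorProduct.mk ℂ A A).flip 1 ∘ₗ antipode ℂ) comul) (comul x) = (1 : A) ⊗ₜ[ℂ] x := by
  have h1 : TensorProduct.lift ((LinearMap.mul ℂ (A ⊗[ℂ] A)).compl₁₂
      ((TensorProduct.mk ℂ A A).flip 1 ∘ₗ antipode ℂ) comul) =
      ((LinearMap.mul' ℂ A ∘ₗ (antipode ℂ).rTensor A).rTensor A) ∘ₗ
        (TensorProduct.assoc ℂ A A A).symm.toLinearMap ∘ₗ (comul (R := ℂ) (A := A)).lTensor A := by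
    ext a b
    simp only [TensorProduct.AlgebraTensorModule.curry_apply, TensorProduct.curry_apply,
      LinearMap.coe_restrictScalars, TensorProduct.lift.tmul, LinearMap.compl₁₂_apply,
      LinearMap.comp_apply, LinearMap.lTensor_tmul, LinearMap.flip_apply,
      TensorProduct.mk_apply, LinearMap.mul_apply', LinearEquiv.coe_coe]
    induction (comul b : A ⊗[ℂ] A) using TensorProduct.induction_on with
    | zero => simp
    | tmul c d => simp
    | add c d hc hd => simp only [mul_add, TensorProduct.tmul_add, map_add, hc, hd]
  rw [h1]
  simp only [LinearMap.comp_apply, LinearEquiv.coe_coe, coassoc_symm_apply]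
  rw [← LinearMap.rTensor_comp_apply, LinearMap.comp_assoc, mul_antipode_rTensor_comul,
    LinearMap.rTensor_comp_apply, rTensor_counit_comul]
  simp

open Coalgebra HopfAlgebra in
/-- If `yΛ = ε(y)Λ` on `K`, then `Λ₁ ⊗ xΛ₂ = S(x)Λ₁ ⊗ Λ₂` for `x ∈ K`. -/
theorem aux_move {A : Type} [Ring A] [HopfAlgebra ℂ A] (K : Subalgebra ℂ A)
    (hK : IsHopfSubalgebra K) (Λ : A) (hΛ : ∀ y ∈ K, y * Λ = counit (R := ℂ) y • Λ)
    (x : A) (hx : x ∈ K) :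
    ((1 : A) ⊗ₜ[ℂ] x) * comul (R := ℂ) Λ = (antipode ℂ x ⊗ₜ[ℂ] (1 : A)) * comul (R := ℂ) Λ := by
  have key : ∀ t : K ⊗[ℂ] K,
      TensorProduct.lift ((LinearMap.mul ℂ (A ⊗[ℂ] A)).compl₁₂
        ((TensorProduct.mk ℂ A A).flip 1 ∘ₗ antipode ℂ) comul)
        (TensorProduct.map K.val.toLinearMap K.val.toLinearMap t) * comul (R := ℂ) Λ =
      (antipode ℂ (TensorProduct.rid ℂ A ((counit (R := ℂ) (A := A)).lTensor A
        (TensorProduct.map K.val.toLinearMap K.val.toLinearMap t))) ⊗ₜ[ℂ] (1 : A)) *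
        comul (R := ℂ) Λ := by
    intro t
    induction t using TensorProduct.induction_on with
    | zero => simp
    | tmul c d =>
      have := hΛ d d.2
      have h2 : comul (R := ℂ) (d : A) * comul (R := ℂ) Λ
          = counit (R := ℂ) (d : A) • comul (R := ℂ) Λ := by
        rw [← Bialgebra.comul_mul, this, map_smul]
      simp [mul_assoc, h2, TensorProduct.smul_tmul', ← TensorProduct.smul_tmul']
    | add c d hc hd => simp only [map_add, add_mul, hc, hd, TensorProduct.add_tmul]
  obtain ⟨t, ht⟩ := hK.1 x hx
  have := key t
  rw [ht, aux_identity, lTensor_counit_comul] at this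
  simpa using this

/-- If `K, L` are Hopf subalgebras of a finite-dimensional semisimple Hopf algebra
`A` over `ℂ` with two-sided idempotent integrals `Λ_K, Λ_L`, and `Λ_K * Λ_L = Λ_L`,
then `K ⊆ L`. -/
theorem hopfSubalgebra_le_of_integral_mul {A : Type} [Ring A]
    [HopfAlgebra ℂ A] [FiniteDimensional ℂ A] [IsSemisimpleRing A]
    (K L : Subalgebra ℂ A) (hK : IsHopfSubalgebra K) (hL : IsHopfSubalgebra L)
    (ΛK ΛL : A) (hΛK : IsIdempotentIntegral K ΛK) (hΛL : IsIdempotentIntegral L ΛL)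
    (h : ΛK * ΛL = ΛL) : K ≤ L := by
  have hKΛ : ∀ y ∈ K, y * ΛL = Coalgebra.counit (R := ℂ) y • ΛL := by
    intro y hy
    rw [← h, ← mul_assoc, (hΛK.2.2 y hy).1, smul_mul_assoc]
  have hLΛ : ∀ y ∈ L, y * ΛL = Coalgebra.counit (R := ℂ) y • ΛL :=
    fun y hy => (hΛL.2.2 y hy).1
  -- right leg map
  let R : Module.Dual ℂ A → (A ⊗[ℂ] A →ₗ[ℂ] A) := fun f =>
    (TensorProduct.lid ℂ A).toLinearMap ∘ₗ f.rTensor A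
  have R_tmul : ∀ f a b, R f (a ⊗ₜ b) = f a • b := by intro f a b; simp [R]
  have R_left : ∀ f (x : A) t, R f (((1 : A) ⊗ₜ[ℂ] x) * t) = x * R f t := by
    intro f x t
    induction t using TensorProduct.induction_on with
    | zero => simp
    | tmul c d => simp [R_tmul]
    | add c d hc hd => simp only [map_add, mul_add, hc, hd]
  have R_right : ∀ f (x : A) t, R f ((x ⊗ₜ[ℂ] (1 : A)) * t)
      = R (f ∘ₗ LinearMap.mulLeft ℂ x) t := by
    intro f x t
    induction t using TensorProduct.induction_on with
    | zero => simp
    | tmul c d => simp [R_tmul]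
    | add c d hc hd => simp only [map_add, mul_add, hc, hd]
  let D : A ⊗[ℂ] A := Coalgebra.comul (R := ℂ) ΛL
  let V : Submodule ℂ A :=
    { carrier := {v | ∃ f, R f D = v}
      zero_mem' := ⟨0, by simp [R]⟩
      add_mem' := by
        rintro _ _ ⟨f, rfl⟩ ⟨g, rfl⟩
        exact ⟨f + g, by simp [R, LinearMap.rTensor_add]⟩
      smul_mem' := by
        rintro c _ ⟨f, rfl⟩
        exact ⟨c • f, by simp [R, LinearMap.rTensor_smul]⟩ }
  have stab : ∀ M : Subalgebra ℂ A, IsHopfSubalgebra M →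
      (∀ y ∈ M, y * ΛL = Coalgebra.counit (R := ℂ) y • ΛL) → ∀ y ∈ M, ∀ v ∈ V, y * v ∈ V := by
    rintro M hM hMΛ y hy _ ⟨f, rfl⟩
    refine ⟨f ∘ₗ LinearMap.mulLeft ℂ (HopfAlgebra.antipode ℂ y), ?_⟩
    rw [← R_right, ← R_left]
    exact congrArg _ (aux_move M hM ΛL hMΛ y hy).symm
  obtain ⟨t, ht⟩ := hL.1 ΛL hΛL.1
  have hVL : ∀ v ∈ V, v ∈ L := by
    rintro _ ⟨f, rfl⟩
    have gen : ∀ t : L ⊗[ℂ] L,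
        R f (TensorProduct.map L.val.toLinearMap L.val.toLinearMap t) ∈ L := by
      intro t
      induction t using TensorProduct.induction_on with
      | zero => simp
      | tmul c d =>
        rw [TensorProduct.map_tmul, R_tmul]
        exact L.smul_mem d.2 _
      | add c d hc hd =>
        rw [map_add, map_add]
        exact L.add_mem hc hd
    change R f (Coalgebra.comul (R := ℂ) ΛL) ∈ L
    rw [← ht]
    exact gen t
  have h1 : (1 : A) ∈ V := by
    let b := Module.finBasis ℂ L
    obtain ⟨c, hc⟩ := TensorProduct.eq_repr_basis_left b t
    have hD : D = ∑ i, (b i : A) ⊗ₜ[ℂ] (c i : A) := by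
      change Coalgebra.comul (R := ℂ) ΛL = _
      rw [← ht, ← hc, Finsupp.sum_fintype _ _ (by simp)]
      simp
    have hcV : ∀ i, (c i : A) ∈ V := by
      intro i
      obtain ⟨g, hg⟩ := LinearMap.exists_extend (p := Subalgebra.toSubmodule L) (b.coord i)
      refine ⟨g, ?_⟩
      have hg' : ∀ j, g (b j : A) = if j = i then 1 else 0 := by
        intro j
        have := LinearMap.congr_fun hg (b j)
        simp only [LinearMap.comp_apply, Submodule.subtype_apply, Module.Basis.coord_apply,
          Module.Basis.repr_self, Finsupp.single_apply] at this
        exact this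
      simp [hD, R_tmul, hg']
    have hS := HopfAlgebra.mul_antipode_rTensor_comul_apply (R := ℂ) ΛL
    rw [hΛL.2.1, map_one] at hS
    rw [← hS]
    change LinearMap.mul' ℂ A ((HopfAlgebra.antipode ℂ).rTensor A D) ∈ V
    rw [hD, map_sum, map_sum]
    refine V.sum_mem fun i _ => ?_
    simp only [LinearMap.rTensor_tmul, LinearMap.mul'_apply]
    exact stab L hL hLΛ _ (hL.2 _ (b i).2) _ (hcV i)
  intro x hx
  have := stab K hK hKΛ x hx 1 h1
  rw [mul_one] at this
  exact hVL x this
end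

section
/- Let G be a finite group with subgroups H ≤ N ≤ G, let T ⊆ G be a complete set of representatives of the double cosets N g H (one element from each double coset), and let α be a class function on H. Then ⟨Res_N(Ind_H^G α), 1_N⟩_N = ∑_{t∈T} ⟨Res_{H ∩ t⁻¹Nt} α, 1⟩_{H ∩ t⁻¹Nt}, where 1_K denotes the trivial character (constant function 1) of a group K and H ∩ t⁻¹Nt is regarded as a subgroup of H. -/
open scoped BigOperators Classical ComplexOrder

/-- Extension by zero. -/
noncomputable def extZ {G : Type} [Group G] (H : Subgroup G) (α : H → ℂ) : G → ℂ :=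
  fun g => if h : g ∈ H then α ⟨g, h⟩ else 0

noncomputable def SS {G : Type} [Group G] [Fintype G] (H N : Subgroup G) (α : H → ℂ) : G → ℂ :=
  fun x => ∑ g : G, if x * g * x⁻¹ ∈ N then extZ H α g else 0

lemma sum_subgroup {G : Type} [Group G] [Fintype G] (K : Subgroup G) (f : G → ℂ) :
    ∑ k : K, f k = ∑ g : G, if g ∈ K then f g else 0 := by
  rw [← Finset.sum_filter]
  exact (Finset.sum_subtype (Finset.univ.filter (fun g => g ∈ K)) (by simp) f).symm

lemma extZ_conj {G : Type} [Group G] (H : Subgroup G) (α : H → ℂ)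
    (hα : ∀ a b : H, α (a * b * a⁻¹) = α b) (b g : G) (hb : b ∈ H) :
    extZ H α (b * g * b⁻¹) = extZ H α g := by
  unfold extZ
  by_cases hg : g ∈ H
  · have h2 : b * g * b⁻¹ ∈ H := H.mul_mem (H.mul_mem hb hg) (H.inv_mem hb)
    rw [dif_pos h2, dif_pos hg]
    exact hα ⟨b, hb⟩ ⟨g, hg⟩
  · have h2 : b * g * b⁻¹ ∉ H := by
      rw [H.mul_mem_cancel_right (H.inv_mem hb), H.mul_mem_cancel_left hb]
      exact hg
    rw [dif_neg h2, dif_neg hg]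

lemma SS_inv {G : Type} [Group G] [Fintype G] (H N : Subgroup G) (α : H → ℂ)
    (hα : ∀ a b : H, α (a * b * a⁻¹) = α b) (a t b : G) (ha : a ∈ N) (hb : b ∈ H) :
    SS H N α (a * t * b) = SS H N α t := by
  unfold SS
  refine Fintype.sum_equiv (MulAut.conj b).toEquiv _ _ (fun g => ?_)
  have e1 : (MulAut.conj b).toEquiv g = b * g * b⁻¹ := rfl
  rw [e1, extZ_conj H α hα b g hb]
  have e2 : a * t * b * g * (a * t * b)⁻¹ = a * (t * (b * g * b⁻¹) * t⁻¹) * a⁻¹ := by group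
  rw [e2, N.mul_mem_cancel_right (N.inv_mem ha), N.mul_mem_cancel_left ha]

lemma SS_eq_sum {G : Type} [Group G] [Fintype G] (H N : Subgroup G) (α : H → ℂ) (x : G) :
    ∑ n : N, extZ H α (x⁻¹ * n * x) = SS H N α x := by
  rw [sum_subgroup N (fun n => extZ H α (x⁻¹ * n * x))]
  unfold SS
  refine Fintype.sum_equiv (MulAut.conj x⁻¹).toEquiv _ _ (fun g => ?_)
  have e1 : (MulAut.conj x⁻¹).toEquiv g = x⁻¹ * g * x := by simp
  rw [e1]
  have e2 : x * (x⁻¹ * g * x) * x⁻¹ = g := by group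
  rw [e2]

lemma fiber_card {G : Type} [Group G] [Fintype G] (H N : Subgroup G) (t x : G)
    (hx : ∃ a ∈ N, ∃ b ∈ H, x = a * t * b) :
    (Finset.univ.filter (fun p : N × H => (p.1 : G) * t * p.2 = x)).card =
      Fintype.card ↥(H ⊓ Subgroup.comap (MulAut.conj t).toMonoidHom N) := by
  obtain ⟨a, ha, b, hb, rfl⟩ := hx
  symm
  rw [← Finset.card_univ]
  refine Finset.card_bij'
    (fun k _ => (⟨a * (t * (k : G) * t⁻¹)⁻¹, N.mul_mem ha (N.inv_mem (by
      have := (Subgroup.mem_inf.mp k.2).2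
      simpa using this))⟩, ⟨k * b, H.mul_mem (Subgroup.mem_inf.mp k.2).1 hb⟩))
    (fun p hp => ⟨(p.2 : G) * b⁻¹, Subgroup.mem_inf.mpr ⟨H.mul_mem p.2.2 (H.inv_mem hb), ?_⟩⟩)
    ?_ ?_ ?_ ?_
  · have h := (Finset.mem_filter.mp hp).2
    have e : t * ((p.2 : G) * b⁻¹) * t⁻¹ = (p.1 : G)⁻¹ * a := by
      have : t * (p.2 : G) = (p.1 : G)⁻¹ * (a * t * b) := by rw [← h]; group
      rw [← mul_assoc t, this]; group
    have : t * ((p.2 : G) * b⁻¹) * t⁻¹ ∈ N := by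
      rw [e]; exact N.mul_mem (N.inv_mem p.1.2) ha
    simpa [mul_assoc] using this
  · intro k _
    simp only [Finset.mem_filter, Finset.mem_univ, true_and]
    group
  · intro p hp
    exact Finset.mem_univ _
  · intro k _
    ext
    simp
  · intro p hp
    have h := (Finset.mem_filter.mp hp).2
    have e : (p.1 : G) = a * t * b * (p.2 : G)⁻¹ * t⁻¹ := by rw [← h]; group
    ext
    · simp only [e]; group
    · simp

lemma coset_card {G : Type} [Group G] [Fintype G] (H N : Subgroup G) (t : G) :
    (Finset.univ.filter (fun x : G => ∃ a ∈ N, ∃ b ∈ H, x = a * t * b)).card *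
      Fintype.card ↥(H ⊓ Subgroup.comap (MulAut.conj t).toMonoidHom N) =
      Fintype.card N * Fintype.card H := by
  rw [← Fintype.card_prod, ← Finset.card_univ (α := N × H)]
  rw [Finset.card_eq_sum_card_fiberwise (f := fun p : N × H => (p.1 : G) * t * p.2)
    (t := Finset.univ.filter (fun x : G => ∃ a ∈ N, ∃ b ∈ H, x = a * t * b))]
  · rw [Finset.sum_congr rfl (fun x hx => fiber_card H N t x (Finset.mem_filter.mp hx).2)]
    simp
  · intro p _
    simp only [Finset.coe_filter, Finset.mem_univ, true_and, Set.mem_setOf_eq]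
    exact ⟨p.1, p.1.2, p.2, p.2.2, rfl⟩

lemma sum_SS {G : Type} [Group G] [Fintype G] (H N : Subgroup G) (T : Finset G)
    (hT : ∀ x : G, ∃! t : G, t ∈ T ∧ ∃ a ∈ N, ∃ b ∈ H, x = a * t * b)
    (α : H → ℂ) (hα : ∀ a b : H, α (a * b * a⁻¹) = α b) :
    ∑ x : G, SS H N α x = ∑ t ∈ T,
      ((Finset.univ.filter (fun x : G => ∃ a ∈ N, ∃ b ∈ H, x = a * t * b)).card : ℂ)
        * SS H N α t := by
  have h1 : ∀ x : G, SS H N α x =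
      ∑ t ∈ T, if (∃ a ∈ N, ∃ b ∈ H, x = a * t * b) then SS H N α t else 0 := by
    intro x
    obtain ⟨t, ⟨htT, hx⟩, hu⟩ := hT x
    rw [Finset.sum_eq_single_of_mem t htT, if_pos hx]
    · obtain ⟨a, ha, b, hb, rfl⟩ := hx
      exact SS_inv H N α hα a t b ha hb
    · intro s hs hne
      exact if_neg (fun h => hne (hu s ⟨hs, h⟩))
  rw [Finset.sum_congr rfl (fun x _ => h1 x), Finset.sum_comm]
  refine Finset.sum_congr rfl (fun t _ => ?_)
  rw [← Finset.sum_filter, Finset.sum_const, nsmul_eq_mul]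

lemma sum_inter {G : Type} [Group G] [Fintype G] (H N : Subgroup G) (α : H → ℂ) (t : G) :
    ∑ x : ↥(H ⊓ Subgroup.comap (MulAut.conj t).toMonoidHom N),
      α ⟨x.1, (Subgroup.mem_inf.mp x.2).1⟩ = SS H N α t := by
  have h1 : ∀ x : ↥(H ⊓ Subgroup.comap (MulAut.conj t).toMonoidHom N),
      α ⟨x.1, (Subgroup.mem_inf.mp x.2).1⟩ = extZ H α x := by
    intro x
    unfold extZ
    rw [dif_pos (Subgroup.mem_inf.mp x.2).1]
  rw [Finset.sum_congr rfl (fun x _ => h1 x), sum_subgroup]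
  unfold SS
  refine Finset.sum_congr rfl (fun g _ => ?_)
  by_cases hg : g ∈ H
  · simp [Subgroup.mem_inf, hg]
  · simp [Subgroup.mem_inf, hg, extZ]

/-- Mackey's formula for the trivial character: if `T` is a complete set of
representatives of the `(N,H)`-double cosets of `G` and `α` is a class function on
`H`, then `⟨Res_N (Ind_H^G α), 1_N⟩_N = ∑_{t ∈ T} ⟨Res_{H ∩ t⁻¹Nt} α, 1⟩`. -/
theorem mackey_trivial_character {G : Type} [Group G] [Fintype G]
    (H N : Subgroup G) (hHN : H ≤ N) (T : Finset G)
    (hT : ∀ x : G, ∃! t : G, t ∈ T ∧ ∃ a ∈ N, ∃ b ∈ H, x = a * t * b)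
    (α : H → ℂ) (hα : ∀ a b : H, α (a * b * a⁻¹) = α b) :
    innerProd N (res N (ind H α)) (fun _ => 1)
      = ∑ t ∈ T,
          innerProd ↥(H ⊓ Subgroup.comap (MulAut.conj t).toMonoidHom N)
            (fun x => α ⟨x.1, (Subgroup.mem_inf.mp x.2).1⟩) (fun _ => 1) := by
  have hL : innerProd N (res N (ind H α)) (fun _ => 1) =
      (Fintype.card N : ℂ)⁻¹ * ((Fintype.card H : ℂ)⁻¹ * ∑ x : G, SS H N α x) := by
    unfold innerProd res ind
    simp only [map_one, mul_one]
    rw [← Finset.mul_sum, Finset.sum_comm]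
    congr 2
    exact Finset.sum_congr rfl (fun x _ => SS_eq_sum H N α x)
  rw [hL, sum_SS H N T hT α hα, Finset.mul_sum, Finset.mul_sum]
  refine Finset.sum_congr rfl (fun t _ => ?_)
  unfold innerProd
  simp only [map_one, mul_one]
  rw [sum_inter H N α t]
  have hc := congrArg (Nat.cast (R := ℂ)) (coset_card H N t)
  rw [Nat.cast_mul, Nat.cast_mul] at hc
  have n1 : (Fintype.card N : ℂ) ≠ 0 := Nat.cast_ne_zero.mpr Fintype.card_ne_zero
  have n2 : (Fintype.card H : ℂ) ≠ 0 := Nat.cast_ne_zero.mpr Fintype.card_ne_zero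
  have n3 : (Fintype.card ↥(H ⊓ Subgroup.comap (MulAut.conj t).toMonoidHom N) : ℂ) ≠ 0 :=
    Nat.cast_ne_zero.mpr Fintype.card_ne_zero
  rw [← mul_assoc, ← mul_assoc, ← mul_inv, ← hc, mul_inv]
  have n4 := left_ne_zero_of_mul (hc ▸ mul_ne_zero n1 n2)
  field_simp
end

section
/- Let G be a finite group with subgroups H ≤ N ≤ G. If ⟨Res_N(Ind_H^G α), 1_N⟩_N = 0 for every irreducible character α of H with α ≠ 1_H, then H is contained in core_G(N) = ∩_{g∈G} g N g⁻¹. -/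
open scoped BigOperators Classical ComplexOrder

/-- If `L`-invariant vectors are `K`-invariant in irreducible representations, then they are so in
every finite-dimensional representation. -/
theorem invariant_of_irreducible {K : Type} [Group K] [Fintype K] (L : Subgroup K)
    (hirr : ∀ (V : Type) [AddCommGroup V] [Module ℂ V] [FiniteDimensional ℂ V]
      (ρ : Representation ℂ K V), ρ.IsIrreducible →
      ∀ v : V, (∀ g ∈ L, ρ g v = v) → ∀ g, ρ g v = v)
    (n : ℕ) : ∀ (V : Type) [AddCommGroup V] [Module ℂ V] [FiniteDimensional ℂ V]
      (ρ : Representation ℂ K V), Module.finrank ℂ V = n →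
      ∀ v : V, (∀ g ∈ L, ρ g v = v) → ∀ g, ρ g v = v := by
  induction n using Nat.strong_induction_on with
  | _ n ih =>
    intro V _ _ _ ρ hn v hv
    by_cases hI : ρ.IsIrreducible
    · exact hirr V ρ hI v hv
    by_cases hv0 : v = 0
    · intro g; simp [hv0]
    have hA : ∃ A : Subrepresentation ρ, A ≠ ⊥ ∧ A ≠ ⊤ := by
      by_contra hcon
      push Not at hcon
      apply hI
      have : Nontrivial (Subrepresentation ρ) := by
        refine ⟨⊥, ⊤, fun h => hv0 ?_⟩
        have h1 : v ∈ (⊤ : Subrepresentation ρ).toSubmodule :=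
          (Submodule.mem_top : v ∈ (⊤ : Submodule ℂ V))
        rw [← h] at h1
        exact (Submodule.mem_bot ℂ).1 h1
      exact ⟨fun a => by
        by_cases h : a = ⊥
        · exact Or.inl h
        · exact Or.inr (hcon a h)⟩
    obtain ⟨A, hAb, hAt⟩ := hA
    obtain ⟨B, hAB⟩ := exists_isCompl A
    have hBt : B ≠ ⊤ := by
      rintro rfl
      exact hAb (eq_bot_of_isCompl_top hAB)
    have hlt : ∀ C : Subrepresentation ρ, C ≠ ⊤ → Module.finrank ℂ C.toSubmodule < n := by
      intro C hC
      rw [← hn]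
      apply Submodule.finrank_lt
      intro h
      exact hC (Subrepresentation.toSubmodule_injective h)
    have hsup : A.toSubmodule ⊔ B.toSubmodule = ⊤ := by
      rw [← Subrepresentation.toSubmodule_sup, hAB.sup_eq_top]; rfl
    have hinf : A.toSubmodule ⊓ B.toSubmodule = ⊥ := by
      rw [← Subrepresentation.toSubmodule_inf, hAB.inf_eq_bot]; rfl
    obtain ⟨a, ha, b, hb, hab⟩ := Submodule.mem_sup.1
      (hsup ▸ Submodule.mem_top : v ∈ A.toSubmodule ⊔ B.toSubmodule)
    have hz : ∀ g ∈ L, ρ g a = a ∧ ρ g b = b := by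
      intro g hg
      have h1 := hv g hg
      rw [← hab, map_add] at h1
      have h2 : ρ g a - a = b - ρ g b := by
        rw [sub_eq_sub_iff_add_eq_add, h1, add_comm]
      have h3 : ρ g a - a ∈ A.toSubmodule ⊓ B.toSubmodule := by
        refine ⟨sub_mem (A.apply_mem_toSubmodule g ha) ha, ?_⟩
        rw [h2]
        exact sub_mem hb (B.apply_mem_toSubmodule g hb)
      rw [hinf, Submodule.mem_bot] at h3
      refine ⟨sub_eq_zero.1 h3, ?_⟩
      rw [h3] at h2
      exact (sub_eq_zero.1 h2.symm).symm
    have key : ∀ C : Subrepresentation ρ, C ≠ ⊤ → ∀ c ∈ C.toSubmodule,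
        (∀ g ∈ L, ρ g c = c) → ∀ g, ρ g c = c := by
      intro C hC c hc hL g
      have := ih _ (hlt C hC) C.toSubmodule C.toRepresentation rfl ⟨c, hc⟩
        (fun g hg => Subtype.ext (hL g hg)) g
      exact congrArg Subtype.val this
    intro g
    rw [← hab, map_add, key A hAt a ha (fun g hg => (hz g hg).1) g,
      key B hBt b hb (fun g hg => (hz g hg).2) g]

/-- The right regular representation on functions. -/
def regRep (K : Type) [Group K] : Representation ℂ K (K → ℂ) where
  toFun g := { toFun := fun f x => f (x * g), map_add' := fun _ _ => rfl,
               map_smul' := fun _ _ => rfl }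
  map_one' := by ext; simp
  map_mul' a b := by
    apply LinearMap.ext
    intro f
    funext x
    simp [mul_assoc]

theorem eq_top_of_irreducible {K : Type} [Group K] [Fintype K] (L : Subgroup K)
    (hirr : ∀ (V : Type) [AddCommGroup V] [Module ℂ V] [FiniteDimensional ℂ V]
      (ρ : Representation ℂ K V), ρ.IsIrreducible →
      ∀ v : V, (∀ g ∈ L, ρ g v = v) → ∀ g, ρ g v = v) (g : K) : g ∈ L := by
  have h := invariant_of_irreducible L hirr _ (K → ℂ) (regRep K) rfl
    (fun x => if x ∈ L then 1 else 0) (by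
      intro g hg
      funext x
      simp [regRep, L.mul_mem_cancel_right hg]) g
  have h1 := congrFun h 1
  by_contra hg
  simp [regRep, hg, L.one_mem] at h1

/-- The average of a character over a subgroup, as a dimension. -/
theorem sum_char_subgroup {K : Type} [Group K] [Fintype K] (L : Subgroup K)
    {V : Type} [AddCommGroup V] [Module ℂ V] [FiniteDimensional ℂ V]
    (ρ : Representation ℂ K V) :
    ∑ l : L, ρ.character (l : K) =
      (Nat.card L * Module.finrank ℂ (Representation.invariants (ρ.comp L.subtype)) : ℕ) := by
  have hne : (Nat.card L : ℂ) ≠ 0 := NeZero.ne _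
  have := invertibleOfNonzero hne
  have h := Representation.card_inv_mul_sum_char_eq_finrank
    (G := L) (k := ℂ) (V := V) (ρ.comp L.subtype)
  push_cast
  rw [← h, mul_inv_cancel_left₀ hne]
  rfl

theorem simple_of_irreducible {K : Type} [Group K] [Fintype K]
    {V : Type} [AddCommGroup V] [Module ℂ V] [FiniteDimensional ℂ V]
    (ρ : Representation ℂ K V) (hρ : ρ.IsIrreducible) :
    CategoryTheory.Simple (FDRep.of ρ) := by
  have hne : (Nat.card K : ℂ) ≠ 0 := NeZero.ne _
  have := invertibleOfNonzero hne
  rw [FDRep.simple_iff_char_is_norm_one]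
  have h := Representation.char_orthonormal ρ ρ
  rw [if_pos ⟨Representation.Equiv.refl ρ⟩, inv_mul_eq_one₀ hne] at h
  exact h.symm

theorem sum_ind {G : Type} [Group G] [Fintype G] (H N : Subgroup G) (α : H → ℂ) :
    innerProd N (res N (ind H α)) (fun _ => 1) =
      (Fintype.card N : ℂ)⁻¹ * ((Fintype.card H : ℂ)⁻¹ * ∑ x : G,
        ∑ l : ((N.comap (MulAut.conj x).toMonoidHom).subgroupOf H), α (l : H)) := by
  unfold innerProd res ind
  simp only [map_one, mul_one]
  rw [← Finset.mul_sum, Finset.sum_comm]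
  congr 2
  refine Finset.sum_congr rfl fun x _ => ?_
  symm
  refine Fintype.sum_of_injective
    (fun l : ((N.comap (MulAut.conj x).toMonoidHom).subgroupOf H) =>
      (⟨x * ((l : H) : G) * x⁻¹, l.2⟩ : N)) ?_ _ _ ?_ ?_
  · intro a b hab
    have := congrArg Subtype.val hab
    simp only [mul_left_inj, mul_right_inj] at this
    exact Subtype.ext (Subtype.ext this)
  · intro n hn
    rw [dif_neg]
    intro hH
    apply hn
    refine ⟨⟨⟨x⁻¹ * n * x, hH⟩, ?_⟩, ?_⟩
    · simp [Subgroup.mem_subgroupOf, mul_assoc]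
    · apply Subtype.ext
      simp [mul_assoc]
  · intro l
    have e : x⁻¹ * (x * ((l : H) : G) * x⁻¹) * x = ((l : H) : G) := by group
    rw [dif_pos (by rw [e]; exact (l : H).2)]
    congr 1
    exact Subtype.ext e.symm

/-- If `⟨Res_N (Ind_H^G α), 1_N⟩_N = 0` for every irreducible character `α ≠ 1_H`
of `H`, then `H` is contained in the normal core of `N` in `G`. -/
theorem le_normalCore_of_resInd_trivial {G : Type} [Group G] [Fintype G]
    (H N : Subgroup G) (hHN : H ≤ N)
    (h : ∀ α : H → ℂ, IsIrrChar H α → α ≠ (fun _ => 1) →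
      innerProd N (res N (ind H α)) (fun _ => 1) = 0) :
    H ≤ N.normalCore := by
  intro a ha x
  let L : G → Subgroup H := fun x => (N.comap (MulAut.conj x).toMonoidHom).subgroupOf H
  suffices hh : (⟨a, ha⟩ : H) ∈ L x from hh
  apply eq_top_of_irreducible
  intro V _ _ _ ρ hρ v hv
  by_cases hα : ρ.character = fun _ => 1
  · -- trivial character: the representation is trivial
    have hne : (Nat.card H : ℂ) ≠ 0 := NeZero.ne _
    have := invertibleOfNonzero hne
    have h1 := Representation.card_inv_mul_sum_char_eq_finrank (G := H) (k := ℂ) (V := V) ρ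
    have h2 := Representation.char_one ρ
    rw [hα] at h1 h2
    simp only [Finset.sum_const, Finset.card_univ, ← Nat.card_eq_fintype_card, nsmul_eq_mul,
      mul_one, inv_mul_cancel₀ hne] at h1
    have h3 : Representation.invariants ρ = ⊤ := by
      apply Submodule.eq_top_of_finrank_eq
      exact_mod_cast h1.symm.trans h2
    have h4 : v ∈ Representation.invariants ρ := h3 ▸ Submodule.mem_top
    exact h4
  · have h0 := h ρ.character ⟨FDRep.of ρ, simple_of_irreducible ρ hρ, rfl⟩ hα
    rw [sum_ind] at h0
    have hN : (Fintype.card N : ℂ)⁻¹ ≠ 0 := inv_ne_zero (NeZero.ne _)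
    have hH : (Fintype.card H : ℂ)⁻¹ ≠ 0 := inv_ne_zero (NeZero.ne _)
    have h1 := (mul_eq_zero.1 ((mul_eq_zero.1 h0).resolve_left hN)).resolve_left hH
    simp only [sum_char_subgroup] at h1
    rw [← Nat.cast_sum, Nat.cast_eq_zero, Finset.sum_eq_zero_iff] at h1
    have h2 := (Nat.mul_eq_zero.1 (h1 x (Finset.mem_univ x))).resolve_left Nat.card_pos.ne'
    have h3 := Submodule.finrank_eq_zero.1 h2
    have h4 : v ∈ Representation.invariants (ρ.comp (L x).subtype) := fun g => hv g g.2
    have h5 : v = 0 := by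
      rw [h3] at h4
      exact (Submodule.mem_bot ℂ).1 h4
    intro g
    simp [h5]
end
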